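/- There exists λ0 > 0 such that for every λ ≥ λ0 the potential 𝒱_λ belongs to the reverse Hölder class B_{N/2}; that is, there exists a constant C > 0 such that for every open ball B ⊂ ℝ^N: ( |B|^{−1} ∫_B 𝒱_λ(x)^{N/2} dx )^{2/N} ≤ C · |B|^{−1} ∫_B 𝒱_λ(x) dx, where |B| denotes the Lebesgue measure of B. -/

import Mathlib

open Real MeasureTheory Metric

/-- The potential `𝒱_λ` associated with the operator `A`. -/
noncomputable def pot (N : ℕ) (α β b c lam : ℝ) (x : EuclideanSpace ℝ (Fin N)) : ℝ :=
  (b ^ 2 / 4 - b * α / 2) * ‖x‖ ^ (2 * α - 2) / (1 + ‖x‖ ^ α) ^ 2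
    + (b / 2) * ((N : ℝ) + α - 2) * ‖x‖ ^ (α - 2) / (1 + ‖x‖ ^ α)
    + (c * ‖x‖ ^ β + lam) / (1 + ‖x‖ ^ α)

/-- Euclidean space of dimension `N`. -/
abbrev EE (N : ℕ) := EuclideanSpace ℝ (Fin N)

lemma cont_w {N : ℕ} (δ : ℝ) : Continuous (fun y : EE N => (1 + ‖y‖) ^ δ) := by
  apply Continuous.rpow_const (by fun_prop)
  intro y; left; positivity

lemma intOn {N : ℕ} {f : EE N → ℝ} (hf : Continuous f) (x : EE N) (r : ℝ) :
    IntegrableOn f (ball x r) volume :=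
  (hf.continuousOn.integrableOn_compact (isCompact_closedBall x r)).mono_set ball_subset_closedBall

lemma upper_const {N : ℕ} {f : EE N → ℝ} (hf : Continuous f) (x : EE N) (r A : ℝ)
    (h : ∀ y ∈ ball x r, f y ≤ A) :
    ∫ y in ball x r, f y ≤ A * volume.real (ball x r) := by
  have := setIntegral_mono_on (intOn hf x r) (intOn (continuous_const (y := A)) x r)
    measurableSet_ball h
  simpa [mul_comm] using this

lemma lower_const {N : ℕ} {f : EE N → ℝ} (hf : Continuous f) (x : EE N) (r A : ℝ)
    (h : ∀ y ∈ ball x r, A ≤ f y) :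
    A * volume.real (ball x r) ≤ ∫ y in ball x r, f y := by
  have := setIntegral_mono_on (intOn (continuous_const (y := A)) x r) (intOn hf x r)
    measurableSet_ball h
  simpa [mul_comm] using this

lemma vol_ball {N : ℕ} (x : EE N) {r : ℝ} (hr : 0 < r) :
    volume.real (ball x r) = r ^ N * volume.real (ball (0 : EE N) 1) := by
  have := Measure.addHaar_ball_of_pos (volume : Measure (EE N)) x hr
  rw [measureReal_def, this, ENNReal.toReal_mul, ENNReal.toReal_ofReal (by positivity)]
  simp [measureReal_def]

lemma vol_pos {N : ℕ} (x : EE N) {r : ℝ} (hr : 0 < r) : 0 < volume.real (ball x r) :=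
  ENNReal.toReal_pos (measure_ball_pos _ _ hr).ne' measure_ball_lt_top.ne

lemma norm_lt_of {N : ℕ} {x y : EE N} {r : ℝ} (h : 1 + ‖x‖ < 2 * r) (hy : y ∈ ball x r) :
    ‖y‖ < 3 * r := by
  have h1 : ‖y - x‖ < r := by simpa [dist_eq_norm] using hy
  have := norm_le_norm_add_norm_sub x y
  have := norm_sub_rev x y
  linarith

lemma upA_nonneg {N : ℕ} (δ : ℝ) (hδ : 0 ≤ δ) : ∃ K : ℝ, 0 < K ∧ ∀ (x : EE N) (r : ℝ), 0 < r →
    1 + ‖x‖ < 2 * r → ∫ y in ball x r, (1 + ‖y‖) ^ δ ≤ K * r ^ δ * volume.real (ball x r) := by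
  refine ⟨5 ^ δ, by positivity, fun x r hr h => upper_const (cont_w δ) x r _ fun y hy => ?_⟩
  rw [← mul_rpow (by norm_num) hr.le]
  have := norm_lt_of h hy
  have := norm_nonneg x
  exact rpow_le_rpow (by positivity) (by linarith) hδ

lemma lowA_nonpos {N : ℕ} (δ : ℝ) (hδ : δ ≤ 0) : ∃ K : ℝ, 0 < K ∧ ∀ (x : EE N) (r : ℝ), 0 < r →
    1 + ‖x‖ < 2 * r → K * r ^ δ * volume.real (ball x r) ≤ ∫ y in ball x r, (1 + ‖y‖) ^ δ := by
  refine ⟨5 ^ δ, by positivity, fun x r hr h => lower_const (cont_w δ) x r _ fun y hy => ?_⟩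
  rw [← mul_rpow (by norm_num) hr.le]
  have := norm_lt_of h hy
  have := norm_nonneg x
  exact rpow_le_rpow_of_nonpos (by positivity) (by linarith) hδ

lemma lowA_nonneg {N : ℕ} (hN : 2 < N) (δ : ℝ) (hδ : 0 ≤ δ) :
    ∃ K : ℝ, 0 < K ∧ ∀ (x : EE N) (r : ℝ), 0 < r →
    1 + ‖x‖ < 2 * r → K * r ^ δ * volume.real (ball x r) ≤ ∫ y in ball x r, (1 + ‖y‖) ^ δ := by
  refine ⟨(1/2) ^ δ * (1 / 2), by positivity, fun x r hr h => ?_⟩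
  have hi := intOn (cont_w (N := N) δ) x r
  have h1 : ∫ y in ball x r \ ball 0 (r/2), (1 + ‖y‖) ^ δ ≤ ∫ y in ball x r, (1 + ‖y‖) ^ δ := by
    apply setIntegral_mono_set hi
    · exact Filter.Eventually.of_forall fun y => by simp only [Pi.zero_apply]; positivity
    · exact Set.sdiff_subset.eventuallyLE
  have h2 : (r/2)^δ * volume.real (ball x r \ ball 0 (r/2)) ≤
      ∫ y in ball x r \ ball 0 (r/2), (1 + ‖y‖) ^ δ := by
    have := setIntegral_mono_on (f := fun _ => (r/2)^δ) (g := fun y : EE N => (1 + ‖y‖) ^ δ)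
      (s := ball x r \ ball 0 (r/2)) (μ := volume)
      ((intOn continuous_const x r).mono_set Set.sdiff_subset)
      (hi.mono_set Set.sdiff_subset) (measurableSet_ball.diff measurableSet_ball) ?_
    · simpa [mul_comm] using this
    · rintro y ⟨_, hy⟩
      have : r / 2 ≤ ‖y‖ := by simpa using hy
      exact rpow_le_rpow (by positivity) (by linarith) hδ
  have h3 : volume.real (ball x r) - volume.real (ball (0 : EE N) (r/2)) ≤
      volume.real (ball x r \ ball 0 (r/2)) := by
    have := measureReal_mono (μ := (volume : Measure (EE N)))
      (s₁ := ball x r) (s₂ := (ball x r \ ball 0 (r/2)) ∪ ball 0 (r/2)) (by intro y hy; by_cases y ∈ ball (0 : EE N) (r/2) <;> simp_all)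
      (measure_union_lt_top ((measure_mono Set.sdiff_subset).trans_lt measure_ball_lt_top) measure_ball_lt_top).ne
    have h4 := measureReal_union_le (μ := (volume : Measure (EE N))) (ball x r \ ball 0 (r/2)) (ball 0 (r/2))
    linarith
  have h4 : volume.real (ball (0 : EE N) (r/2)) ≤ (1/2) * volume.real (ball x r) := by
    rw [vol_ball _ hr, vol_ball _ (half_pos hr), div_pow]
    have : (2:ℝ)^1 ≤ 2^N := pow_le_pow_right₀ (by norm_num) (by omega)
    have h5 : r^N / 2^N ≤ r^N / 2 := div_le_div_of_nonneg_left (by positivity) (by norm_num) (by simpa using this)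
    have := mul_le_mul_of_nonneg_right h5 (measureReal_nonneg (μ := volume) (s := ball (0 : EE N) 1))
    linarith
  have e : (1/2 : ℝ)^δ * (1/2) * r^δ * volume.real (ball x r) = (r/2)^δ * ((1/2) * volume.real (ball x r)) := by
    rw [div_eq_mul_one_div r, mul_rpow hr.le (by norm_num)]; ring
  rw [e]
  refine le_trans ?_ (h2.trans h1)
  exact mul_le_mul_of_nonneg_left (by linarith) (by positivity)

lemma upA_neg {N : ℕ} (hN : 2 < N) (δ : ℝ) (hδ : δ < 0) (hδ' : -(N:ℝ) < δ) :
    ∃ K : ℝ, 0 < K ∧ ∀ (x : EE N) (r : ℝ), 0 < r →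
    1 + ‖x‖ < 2 * r → ∫ y in ball x r, (1 + ‖y‖) ^ δ ≤ K * r ^ δ * volume.real (ball x r) := by
  have hNd : 0 < N + δ := by linarith
  have hN0 : (0:ℝ) < N := by exact_mod_cast (by omega : 0 < N)
  have : Nonempty (Fin N) := ⟨⟨0, by omega⟩⟩
  refine ⟨N * (3 ^ (N + δ) / (N + δ)), by positivity, fun x r hr h => ?_⟩
  set F : ℝ → ℝ := fun t => (Set.Iio (3 * r)).indicator (fun t => t ^ δ) t with hF
  have hIeq : ∀ t ∈ Set.Ioi (0:ℝ), t ^ (N - 1) • F t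
      = (Set.Ioo 0 (3*r)).indicator (fun t => t ^ ((N:ℝ) - 1 + δ)) t := by
    intro t ht
    have ht : 0 < t := ht
    by_cases h3 : t < 3 * r
    · have : (t ^ (N-1) : ℝ) = t ^ ((N:ℝ) - 1) := by
        rw [← rpow_natCast, Nat.cast_sub (by omega)]; simp
      simp [hF, h3, ht, this, rpow_add ht]
    · simp [hF, h3]
  have hint0 : IntegrableOn (fun t : ℝ => t ^ ((N:ℝ) - 1 + δ)) (Set.Ioo 0 (3*r)) := by
    have := intervalIntegral.intervalIntegrable_rpow' (a := 0) (b := 3*r) (r := (N:ℝ) - 1 + δ) (by linarith)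
    rw [intervalIntegrable_iff_integrableOn_Ioo_of_le (by positivity)] at this
    exact this
  have hIo : IntegrableOn (fun t => t ^ (N - 1) • F t) (Set.Ioi 0) := by
    rw [integrableOn_congr_fun hIeq measurableSet_Ioi]
    exact ((integrable_indicator_iff measurableSet_Ioo).2 hint0).integrableOn
  have hval : ∫ t in Set.Ioi (0:ℝ), t ^ (N - 1) • F t = (3*r)^((N:ℝ)+δ) / (N + δ) := by
    rw [setIntegral_congr_fun measurableSet_Ioi hIeq, setIntegral_indicator measurableSet_Ioo]
    have : Set.Ioi (0:ℝ) ∩ Set.Ioo 0 (3*r) = Set.Ioo 0 (3*r) := by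
      ext; simp
    rw [this, ← integral_Ioc_eq_integral_Ioo, ← intervalIntegral.integral_of_le (by positivity),
      integral_rpow (Or.inl (by linarith))]
    rw [show (N:ℝ) - 1 + δ + 1 = N + δ by ring, zero_rpow hNd.ne', sub_zero]
  have hFi : Integrable (fun y : EE N => F ‖y‖) := by
    rw [integrable_fun_norm_addHaar]
    simpa using hIo
  have hFv := integral_fun_norm_addHaar (volume : Measure (EE N)) F
  have hne : ∀ᵐ y : EE N, y ≠ 0 := by
    simp [ae_iff]
  have hFnn : ∀ y : EE N, 0 ≤ F ‖y‖ := fun y => by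
    simp only [hF, Set.indicator_apply]; split_ifs <;> positivity
  have h1 : ∫ y in ball x r, (1 + ‖y‖) ^ δ ≤ ∫ y in ball x r, F ‖y‖ := by
    apply setIntegral_mono_on_ae (intOn (cont_w δ) x r) hFi.integrableOn measurableSet_ball
    filter_upwards [hne] with y hy hyb
    have h3 := norm_lt_of h hyb
    simp only [hF]
    rw [Set.indicator_of_mem (by simpa using h3)]
    have := norm_pos_iff.2 hy
    exact rpow_le_rpow_of_nonpos this (by linarith) hδ.le
  have h2 : ∫ y in ball x r, F ‖y‖ ≤ ∫ y, F ‖y‖ :=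
    setIntegral_le_integral hFi (Filter.Eventually.of_forall hFnn)
  refine h1.trans (h2.trans (le_of_eq ?_))
  rw [hFv]
  simp only [finrank_euclideanSpace, Fintype.card_fin]
  rw [hval, vol_ball x hr, mul_rpow (by norm_num) hr.le, rpow_add hr, rpow_natCast]
  simp only [nsmul_eq_mul, smul_eq_mul]
  ring

lemma upA {N : ℕ} (hN : 2 < N) (δ : ℝ) (hδ' : -(N:ℝ) < δ) :
    ∃ K : ℝ, 0 < K ∧ ∀ (x : EE N) (r : ℝ), 0 < r →
    1 + ‖x‖ < 2 * r → ∫ y in ball x r, (1 + ‖y‖) ^ δ ≤ K * r ^ δ * volume.real (ball x r) := by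
  rcases lt_or_ge δ 0 with h | h
  · exact upA_neg hN δ h hδ'
  · exact upA_nonneg δ h

lemma lowA {N : ℕ} (hN : 2 < N) (δ : ℝ) :
    ∃ K : ℝ, 0 < K ∧ ∀ (x : EE N) (r : ℝ), 0 < r →
    1 + ‖x‖ < 2 * r → K * r ^ δ * volume.real (ball x r) ≤ ∫ y in ball x r, (1 + ‖y‖) ^ δ := by
  rcases le_total δ 0 with h | h
  · exact lowA_nonpos δ h
  · exact lowA_nonneg hN δ h

lemma cmp_pow {a s : ℝ} (ha : 0 < a) (hs : 0 < s) (h1 : a ≤ 2 * s) (h2 : s ≤ 2 * a) (δ : ℝ) :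
    s ^ δ ≤ 2 ^ |δ| * a ^ δ := by
  rcases le_total 0 δ with h | h
  · rw [abs_of_nonneg h, ← mul_rpow (by norm_num) ha.le]
    exact rpow_le_rpow hs.le h2 h
  · have : (2:ℝ) ^ |δ| * a ^ δ = (a / 2) ^ δ := by
      rw [abs_of_nonpos h, div_rpow ha.le (by norm_num), rpow_neg (by norm_num)]
      field_simp
    rw [this]
    exact rpow_le_rpow_of_nonpos (by positivity) (by linarith) h

lemma cmp_ball {N : ℕ} {x y : EE N} {r : ℝ} (h : 2 * r ≤ 1 + ‖x‖) (hy : y ∈ ball x r) :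
    1 + ‖x‖ ≤ 2 * (1 + ‖y‖) ∧ 1 + ‖y‖ ≤ 2 * (1 + ‖x‖) := by
  have h1 : ‖y - x‖ < r := by simpa [dist_eq_norm] using hy
  have h2 := norm_le_norm_add_norm_sub x y
  have h3 := norm_le_norm_add_norm_sub y x
  have := norm_sub_rev x y
  have := norm_nonneg x
  constructor <;> linarith

lemma main1 {N : ℕ} (hN : 2 < N) (γ : ℝ) (hγ : -2 < γ) :
    ∃ K k : ℝ, 0 < K ∧ 0 < k ∧ ∀ (x : EE N) (r : ℝ), 0 < r → ∃ L : ℝ, 0 < L ∧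
      ∫ y in ball x r, ((1 + ‖y‖) ^ γ) ^ ((N:ℝ)/2) ≤ K * L ^ ((N:ℝ)/2) * volume.real (ball x r) ∧
      k * L * volume.real (ball x r) ≤ ∫ y in ball x r, (1 + ‖y‖) ^ γ := by
  have hN0 : (0:ℝ) < N := by exact_mod_cast (by omega : 0 < N)
  obtain ⟨K, hK, hup⟩ := upA hN (γ * ((N:ℝ)/2)) (by nlinarith)
  obtain ⟨k, hk, hlow⟩ := lowA hN γ
  have e : ∀ y : EE N, ((1 + ‖y‖) ^ γ) ^ ((N:ℝ)/2) = (1 + ‖y‖) ^ (γ * ((N:ℝ)/2)) := fun y => by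
    rw [rpow_mul (by positivity)]
  simp_rw [e]
  refine ⟨max K (2 ^ |γ * ((N:ℝ)/2)|), min k ((2 ^ |γ|)⁻¹), by positivity, by positivity,
    fun x r hr => ?_⟩
  have hv := vol_pos x hr
  rcases lt_or_ge (1 + ‖x‖) (2 * r) with h | h
  · refine ⟨r ^ γ, by positivity, ?_, ?_⟩
    · rw [← rpow_mul hr.le]
      refine (hup x r hr h).trans ?_
      gcongr
      exact le_max_left _ _
    · refine le_trans ?_ (hlow x r hr h)
      gcongr
      exact min_le_left _ _
  · have hx : 0 < 1 + ‖x‖ := by positivity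
    refine ⟨(1 + ‖x‖) ^ γ, by positivity, ?_, ?_⟩
    · rw [← rpow_mul hx.le]
      refine upper_const (cont_w _) x r _ fun y hy => ?_
      obtain ⟨h1, h2⟩ := cmp_ball h hy
      refine (cmp_pow hx (by positivity) h1 h2 _).trans ?_
      gcongr
      exact le_max_right _ _
    · refine lower_const (cont_w _) x r _ fun y hy => ?_
      obtain ⟨h1, h2⟩ := cmp_ball h hy
      have hy0 : 0 < 1 + ‖y‖ := by positivity
      have h3 := cmp_pow hy0 hx h2 h1 γ
      calc _ ≤ (2 ^ |γ|)⁻¹ * (1 + ‖x‖) ^ γ := by gcongr; exact min_le_right _ _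
        _ ≤ _ := by rw [inv_mul_le_iff₀ (by positivity)]; exact h3

lemma main2 {N : ℕ} (hN : 2 < N) (γ : ℝ) (hγ : -2 < γ) (f : EE N → ℝ) (hf : Continuous f)
    (k1 k2 : ℝ) (hk1 : 0 < k1) (hk2 : 0 < k2) (h1 : ∀ y, k1 * (1 + ‖y‖) ^ γ ≤ f y)
    (h2 : ∀ y, f y ≤ k2 * (1 + ‖y‖) ^ γ) :
    ∃ C : ℝ, 0 < C ∧ ∀ (x : EE N) (r : ℝ), 0 < r →
        ((volume (ball x r)).toReal⁻¹
            * ∫ y in ball x r, f y ^ ((N : ℝ) / 2)) ^ ((2 : ℝ) / (N : ℝ)) ≤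
          C * ((volume (ball x r)).toReal⁻¹ * ∫ y in ball x r, f y) := by
  have hN0 : (0:ℝ) < N := by exact_mod_cast (by omega : 0 < N)
  obtain ⟨K, k, hK, hk, H⟩ := main1 hN γ hγ
  set q : ℝ := (N:ℝ)/2 with hq
  have hq0 : 0 < q := by positivity
  have hqi : (2:ℝ)/N = q⁻¹ := by rw [hq]; field_simp
  have hf0 : ∀ y, 0 ≤ f y := fun y => le_trans (by positivity) (h1 y)
  refine ⟨k2 * K ^ q⁻¹ / (k1 * k), by positivity, fun x r hr => ?_⟩
  obtain ⟨L, hL, ha, hb⟩ := H x r hr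
  have hv := vol_pos x hr
  change ((volume.real (ball x r))⁻¹ * _) ^ _ ≤ _ * ((volume.real (ball x r))⁻¹ * _)
  set v := volume.real (ball x r)
  have A : ∫ y in ball x r, f y ^ q ≤ k2 ^ q * (K * L ^ q * v) := by
    refine le_trans ?_ (mul_le_mul_of_nonneg_left ha (by positivity))
    rw [← integral_const_mul]
    have c1 : Continuous fun y => f y ^ q := hf.rpow_const fun _ => Or.inr hq0.le
    have c2 : Continuous fun y : EE N => k2 ^ q * ((1 + ‖y‖) ^ γ) ^ q :=
      continuous_const.mul ((cont_w γ).rpow_const fun _ => Or.inr hq0.le)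
    refine setIntegral_mono_on (intOn c1 x r) (intOn c2 x r) measurableSet_ball fun y _ => ?_
    rw [← mul_rpow hk2.le (by positivity)]
    exact rpow_le_rpow (hf0 y) (h2 y) hq0.le
  have B : k1 * (k * L * v) ≤ ∫ y in ball x r, f y := by
    refine le_trans (mul_le_mul_of_nonneg_left hb hk1.le) ?_
    rw [← integral_const_mul]
    exact setIntegral_mono_on (intOn (continuous_const.mul (cont_w γ)) x r) (intOn hf x r)
      measurableSet_ball fun y _ => h1 y
  have A0 : 0 ≤ ∫ y in ball x r, f y ^ q := integral_nonneg fun y => rpow_nonneg (hf0 y) _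
  have A' : v⁻¹ * ∫ y in ball x r, f y ^ q ≤ (k2 * L) ^ q * K := by
    rw [inv_mul_le_iff₀ hv, mul_rpow hk2.le hL.le]; linarith
  have B' : k1 * k * L ≤ v⁻¹ * ∫ y in ball x r, f y := by
    rw [le_inv_mul_iff₀ hv]; linarith
  rw [hqi]
  calc _ ≤ ((k2 * L) ^ q * K) ^ q⁻¹ := rpow_le_rpow (by positivity) A' (by positivity)
    _ = k2 * K ^ q⁻¹ / (k1 * k) * (k1 * k * L) := by
      rw [mul_rpow (by positivity) hK.le, rpow_rpow_inv (by positivity) hq0.ne']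
      field_simp
    _ ≤ _ := by gcongr

lemma two_sided {t a : ℝ} (ht : 0 ≤ t) (ha : 0 < a) :
    (1 + t) ^ a ≤ 2 ^ a * (1 + t ^ a) ∧ 1 + t ^ a ≤ 2 * (1 + t) ^ a := by
  have h0 : 0 ≤ t ^ a := by positivity
  constructor
  · rcases le_total t 1 with h | h
    · calc (1 + t) ^ a ≤ 2 ^ a := rpow_le_rpow (by positivity) (by linarith) ha.le
        _ ≤ _ := le_mul_of_one_le_right (by positivity) (by linarith)
    · calc (1 + t) ^ a ≤ (2 * t) ^ a := rpow_le_rpow (by positivity) (by linarith) ha.le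
        _ = 2 ^ a * t ^ a := mul_rpow (by norm_num) ht
        _ ≤ _ := by gcongr; linarith
  · have h1 : t ^ a ≤ (1 + t) ^ a := rpow_le_rpow ht (by linarith) ha.le
    have h2 : 1 ≤ (1 + t) ^ a := one_le_rpow (by linarith) ha.le
    linarith

lemma absorb {c p β K : ℝ} (hc : 0 < c) (hp : 0 < p) (hpb : p < β) (hK : 0 ≤ K) :
    ∃ M : ℝ, 0 ≤ M ∧ ∀ t : ℝ, 0 ≤ t → K * t ^ p ≤ c / 2 * t ^ β + M := by
  have hd : 0 < β - p := by linarith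
  set T : ℝ := (2 * K / c) ^ (β - p)⁻¹ with hT
  have hT0 : 0 ≤ T := by positivity
  refine ⟨K * T ^ p, by positivity, fun t ht => ?_⟩
  rcases le_total t T with h | h
  · have : t ^ p ≤ T ^ p := rpow_le_rpow ht h hp.le
    have h2 : 0 ≤ c / 2 * t ^ β := by positivity
    have := mul_le_mul_of_nonneg_left this hK
    linarith
  · have h1 : 2 * K / c ≤ t ^ (β - p) := by
      have := rpow_le_rpow hT0 h hd.le
      rwa [hT, rpow_inv_rpow (by positivity) hd.ne'] at this
    have h2 : t ^ β = t ^ (β - p) * t ^ p := by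
      rw [← rpow_add_of_nonneg ht hd.le hp.le]; congr 1; ring
    have h3 : K ≤ c / 2 * t ^ (β - p) := by
      rw [div_le_iff₀ hc] at h1; linarith
    have h4 : 0 ≤ t ^ p := by positivity
    have h5 : 0 ≤ K * T ^ p := by positivity
    rw [h2]
    nlinarith

lemma pot_cont (N : ℕ) (α β b c lam : ℝ) (hα : 2 < α) (hβ : α - 2 < β) :
    Continuous (pot N α β b c lam) := by
  unfold pot
  have hn : ∀ a : ℝ, 0 < a → Continuous fun x : EE N => ‖x‖ ^ a := fun a ha =>
    continuous_norm.rpow_const fun _ => Or.inr ha.le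
  have c1 := hn (2 * α - 2) (by linarith)
  have c2 := hn (α - 2) (by linarith)
  have c3 := hn α (by linarith)
  have c4 := hn β (by linarith)
  have hpos : ∀ x : EE N, 1 + ‖x‖ ^ α ≠ 0 := fun x => by positivity
  refine ((Continuous.div (by fun_prop) (by fun_prop) fun x => pow_ne_zero 2 (hpos x)).add
    (Continuous.div (by fun_prop) (by fun_prop) hpos)).add
    (Continuous.div (by fun_prop) (by fun_prop) hpos)

/-- There is `λ0 > 0` such that for every `λ ≥ λ0` the potential `𝒱_λ`
belongs to the reverse Hölder class `B_{N/2}`: there is `C > 0` such that for every ball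
`B = B(x,r)`, `(|B|⁻¹ ∫_B 𝒱_λ^{N/2})^{2/N} ≤ C |B|⁻¹ ∫_B 𝒱_λ`. -/
theorem stmt16 (N : ℕ) (hN : 2 < N) (α β b c : ℝ) (hα : 2 < α) (hβ : α - 2 < β)
    (hc : 0 < c) :
    ∃ lam0 : ℝ, 0 < lam0 ∧ ∀ lam : ℝ, lam0 ≤ lam →
      ∃ C : ℝ, 0 < C ∧ ∀ (x : EuclideanSpace ℝ (Fin N)) (r : ℝ), 0 < r →
        ((volume (ball x r)).toReal⁻¹
            * ∫ y in ball x r, pot N α β b c lam y ^ ((N : ℝ) / 2)) ^ ((2 : ℝ) / (N : ℝ)) ≤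
          C * ((volume (ball x r)).toReal⁻¹ * ∫ y in ball x r, pot N α β b c lam y) := by
  set P : ℝ := b ^ 2 / 4 - b * α / 2 with hP
  set Q : ℝ := (b / 2) * ((N : ℝ) + α - 2) with hQ
  obtain ⟨M, hM, hab⟩ := absorb (c := c) (p := α - 2) (β := β) (K := |P| + |Q|) hc
    (by linarith) hβ (by positivity)
  have hβ0 : 0 < β := by linarith
  have hα0 : 0 < α := by linarith
  refine ⟨M + 1, by positivity, fun lam hlam => ?_⟩
  -- pointwise bound
  have key : ∀ y : EE N, |pot N α β b c lam y - (c * ‖y‖ ^ β + lam) / (1 + ‖y‖ ^ α)| ≤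
      (c / 2 * ‖y‖ ^ β + M) / (1 + ‖y‖ ^ α) := by
    intro y
    set t := ‖y‖ with ht
    have ht0 : 0 ≤ t := norm_nonneg y
    have hD : 0 < 1 + t ^ α := by positivity
    have e1 : t ^ (2 * α - 2) = t ^ α * t ^ (α - 2) := by
      rw [← rpow_add_of_nonneg ht0 hα0.le (by linarith)]; congr 1; ring
    have e : pot N α β b c lam y - (c * t ^ β + lam) / (1 + t ^ α)
        = (P * (t ^ α / (1 + t ^ α)) + Q) * t ^ (α - 2) / (1 + t ^ α) := by
      unfold pot
      rw [← ht, e1, ← hP, ← hQ]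
      field_simp
      ring
    rw [e, abs_div, abs_of_pos hD, abs_mul, abs_of_nonneg (by positivity : 0 ≤ t ^ (α - 2))]
    refine div_le_div_of_nonneg_right ?_ hD.le
    refine le_trans ?_ (hab t ht0)
    refine mul_le_mul_of_nonneg_right ?_ (by positivity)
    refine (abs_add_le _ _).trans ?_
    have hfr : t ^ α / (1 + t ^ α) ≤ 1 := by rw [div_le_one hD]; linarith
    rw [abs_mul, abs_of_nonneg (by positivity : 0 ≤ t ^ α / (1 + t ^ α))]
    have := mul_le_of_le_one_right (abs_nonneg P) hfr
    linarith
  have ew : ∀ y : EE N, (1 + ‖y‖) ^ (β - α) = (1 + ‖y‖) ^ β / (1 + ‖y‖) ^ α := fun y =>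
    rpow_sub (by positivity) _ _
  set m : ℝ := min (c / 2) 1 with hm
  have hm0 : 0 < m := by positivity
  set M' : ℝ := 3 * c / 2 + lam + M with hM'
  have hM'0 : 0 < M' := by rw [hM']; linarith
  refine main2 hN (β - α) (by linarith) _ (pot_cont N α β b c lam hα hβ)
    (m / (2 ^ β * 2)) (M' * 2 * 2 ^ α) (by positivity) (by positivity) ?_ ?_
  · intro y
    have hk := (abs_le.1 (key y)).1
    rw [ew]
    set t := ‖y‖ with ht
    have ht0 : 0 ≤ t := norm_nonneg y
    have hD : 0 < 1 + t ^ α := by positivity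
    have hb := (two_sided ht0 hβ0).1
    have ha := (two_sided ht0 hα0).2
    have hl : m * (1 + t ^ β) ≤ (c * t ^ β + lam) - (c / 2 * t ^ β + M) := by
      have h1 := min_le_left (c / 2) 1
      have h2 := min_le_right (c / 2) 1
      have := mul_le_mul_of_nonneg_right h1 (by positivity : 0 ≤ t ^ β)
      rw [← hm] at *
      linarith
    calc m / (2 ^ β * 2) * ((1 + t) ^ β / (1 + t) ^ α)
        = m * ((1 + t) ^ β / 2 ^ β) / (2 * (1 + t) ^ α) := by field_simp
      _ ≤ m * (1 + t ^ β) / (1 + t ^ α) := by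
        gcongr
        rw [div_le_iff₀ (by positivity)]; linarith
      _ ≤ ((c * t ^ β + lam) - (c / 2 * t ^ β + M)) / (1 + t ^ α) := by gcongr
      _ ≤ _ := by rw [sub_div]; linarith
  · intro y
    have hk := (abs_le.1 (key y)).2
    rw [ew]
    set t := ‖y‖ with ht
    have ht0 : 0 ≤ t := norm_nonneg y
    have hD : 0 < 1 + t ^ α := by positivity
    have hb := (two_sided ht0 hβ0).2
    have ha := (two_sided ht0 hα0).1
    have hl : (c * t ^ β + lam) + (c / 2 * t ^ β + M) ≤ M' * (1 + t ^ β) := by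
      have : 0 ≤ (lam + M) * t ^ β := mul_nonneg (by linarith) (by positivity)
      rw [hM']; nlinarith
    calc pot N α β b c lam y ≤ ((c * t ^ β + lam) + (c / 2 * t ^ β + M)) / (1 + t ^ α) := by
          rw [add_div]; linarith
      _ ≤ M' * (1 + t ^ β) / (1 + t ^ α) := by gcongr
      _ ≤ M' * (2 * (1 + t) ^ β) / ((1 + t) ^ α / 2 ^ α) := by
        gcongr
        rw [div_le_iff₀ (by positivity)]; linarith
      _ = _ := by field_simp
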